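/- For each l ∈ {1,2,3} and any symmetric (0,2)-tensor field ĥ on S², ∫_{S²} x^l ε^{ac} ∇_c ∇_b ĥ^b_a dμ = 0, where ε is the area form and ∇ the Levi-Civita connection of the round metric. -/

import Mathlib

open MeasureTheory RealInnerProductSpace

noncomputable section

/-- Euclidean 3-space. -/
abbrev E3 := EuclideanSpace ℝ (Fin 3)

/-- The unit sphere `S²` in `ℝ³`. -/
abbrev S2 := Metric.sphere (0 : E3) 1

/-- The surface (area) measure on the unit sphere, normalized so that
the total area is `4π`. -/
abbrev sphereMeasure : Measure S2 := (volume : Measure E3).toSphere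

/-- The restriction of the `i`-th Cartesian coordinate function to the sphere. -/
def coordFn (i : Fin 3) (p : S2) : ℝ := (p : E3) i

/-- The `i`-th standard basis vector of `ℝ³`. -/
def e3 (i : Fin 3) : E3 := EuclideanSpace.single i (1 : ℝ)

open scoped Classical in
/-- The degree-zero homogeneous extension of a function on the unit sphere to `ℝ³`. -/
def homExt (A : S2 → ℝ) : E3 → ℝ := fun x =>
  if hx : ‖x‖⁻¹ • x ∈ S2 then A ⟨‖x‖⁻¹ • x, hx⟩ else 0

/-- The Euclidean Laplacian of a function on `ℝ³`. -/
def eLap (f : E3 → ℝ) (x : E3) : ℝ :=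
  ∑ i : Fin 3, iteratedFDeriv ℝ 2 f x ![e3 i, e3 i]

/-- The Laplace–Beltrami operator of the round metric on the unit sphere,
computed as the Euclidean Laplacian of the degree-zero homogeneous extension. -/
def sphereLap (A : S2 → ℝ) (p : S2) : ℝ := eLap (homExt A) (p : E3)

/-- The (round) gradient of a function on the unit sphere, viewed as a vector in `ℝ³`
tangent to the sphere: the Euclidean gradient of the degree-zero homogeneous extension. -/
def sphereGrad (A : S2 → ℝ) (p : S2) : E3 := gradient (homExt A) (p : E3)


/-- The cross product of two vectors in `ℝ³`. -/
def cross3 (a b : E3) : E3 :=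
  (WithLp.equiv 2 (Fin 3 → ℝ)).symm
    ![a 1 * b 2 - a 2 * b 1, a 2 * b 0 - a 0 * b 2, a 0 * b 1 - a 1 * b 0]

/-- Tangential projection (w.r.t. the position vector `x`). -/
def tangProj (x v : E3) : E3 := v - (⟪x, v⟫ / ⟪x, x⟫) • x

/-- The vector field dual (sharp) of the one-form `∇_b ĥ^b_a` on the sphere, the divergence
of a tangential symmetric 2-tensor `ĥ` (given as an ambient field `H`), computed via the
ambient derivative: for tangential homogeneous tensors, the sphere covariant derivative of
`H` on tangent vectors agrees with the ambient derivative. -/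
def tensorDivVec (H : E3 → E3 →L[ℝ] E3 →L[ℝ] ℝ) (x : E3) : E3 :=
  ∑ i : Fin 3,
    (∑ j : Fin 3, fderiv ℝ H x (tangProj x (e3 j)) (tangProj x (e3 j)) (e3 i)) • e3 i

/-- The curl of a vector field on `ℝ³`. -/
def curl3 (W : E3 → E3) (x : E3) : E3 :=
  (WithLp.equiv 2 (Fin 3 → ℝ)).symm
    ![fderiv ℝ (fun y => W y 2) x (e3 1) - fderiv ℝ (fun y => W y 1) x (e3 2),
      fderiv ℝ (fun y => W y 0) x (e3 2) - fderiv ℝ (fun y => W y 2) x (e3 0),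
      fderiv ℝ (fun y => W y 1) x (e3 0) - fderiv ℝ (fun y => W y 0) x (e3 1)]

open scoped Pointwise in
/-- Linear isometries preserve the sphere measure. -/
theorem sphere_integral_comp (R : E3 ≃ₗᵢ[ℝ] E3) (ρ : S2 → S2) (hρ : ∀ p, (ρ p : E3) = R p)
    (g : S2 → ℝ) (hg : Continuous g) :
    ∫ p, g (ρ p) ∂sphereMeasure = ∫ p, g p ∂sphereMeasure := by
  have hc : Continuous ρ := by
    rw [continuous_induced_rng]
    have : (Subtype.val ∘ ρ) = fun p : S2 => R p := by
      funext p; exact hρ p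
    rw [this]
    exact R.continuous.comp continuous_subtype_val
  have hmap : Measure.map ρ sphereMeasure = sphereMeasure := by
    ext s hs
    rw [Measure.map_apply hc.measurable hs, Measure.toSphere_apply' _ hs,
      Measure.toSphere_apply' _ (hc.measurable hs)]
    congr 1
    refine Eq.trans ?_ ((R.measurePreserving).measure_preimage_equiv
      (f := R.toHomeomorph.toMeasurableEquiv) _)
    congr 1
    ext x
    simp only [Set.mem_smul, Set.mem_image, Set.mem_preimage]
    constructor
    · rintro ⟨r, hr, y, ⟨q, hq, rfl⟩, rfl⟩
      exact ⟨r, hr, _, ⟨ρ q, hq, rfl⟩, by rw [hρ]; exact (R.map_smul r _).symm⟩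
    · rintro ⟨r, hr, y, ⟨q, hq, rfl⟩, h⟩
      have hq' : R.symm (q : E3) ∈ S2 := by
        have := q.2
        simp only [mem_sphere_zero_iff_norm] at this ⊢
        simp
      refine ⟨r, hr, _, ⟨⟨_, hq'⟩, ?_, rfl⟩, ?_⟩
      · have : ρ ⟨_, hq'⟩ = q := by
          apply Subtype.ext; rw [hρ]; simp
        rw [this]; exact hq
      · change r • (q : E3) = R x at h
        change r • R.symm (q : E3) = x
        rw [← R.symm.map_smul, h]; simp
  calc ∫ p, g (ρ p) ∂sphereMeasure = ∫ p, g p ∂(Measure.map ρ sphereMeasure) := by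
        rw [integral_map hc.aemeasurable hg.aestronglyMeasurable]
    _ = _ := by rw [hmap]

/-- The rotation field about the `m`-th axis. -/
def rotF (m : Fin 3) (x : E3) : E3 := cross3 (e3 m) x

/-- Rodrigues rotation about the `m`-th axis. -/
def rodr (m : Fin 3) (t : ℝ) (x : E3) : E3 :=
  x + Real.sin t • rotF m x + (1 - Real.cos t) • rotF m (rotF m x)

theorem rotF_add (m : Fin 3) (x y : E3) : rotF m (x + y) = rotF m x + rotF m y := by
  ext i; fin_cases i <;> simp [rotF, cross3] <;> ring

theorem rotF_smul (m : Fin 3) (c : ℝ) (x : E3) : rotF m (c • x) = c • rotF m x := by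
  ext i; fin_cases i <;> simp [rotF, cross3] <;> ring

theorem rotF_cube (m : Fin 3) (x : E3) : rotF m (rotF m (rotF m x)) = - rotF m x := by
  ext i; fin_cases m <;> fin_cases i <;> simp [rotF, cross3, e3]

theorem norm_rodr (m : Fin 3) (t : ℝ) (x : E3) : ‖rodr m t x‖ = ‖x‖ := by
  rw [EuclideanSpace.norm_eq, EuclideanSpace.norm_eq]
  congr 1
  have h := Real.sin_sq_add_cos_sq t
  simp only [Real.norm_eq_abs, sq_abs, Fin.sum_univ_three]
  fin_cases m <;> simp [rodr, rotF, cross3, e3]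
  · linear_combination (x 1 ^2 + x 2 ^2) * h
  · linear_combination (x 0 ^2 + x 2 ^2) * h
  · linear_combination (x 0 ^2 + x 1 ^2) * h

/-- The rotation as a linear isometry equivalence. -/
def rotE (m : Fin 3) (t : ℝ) : E3 ≃ₗᵢ[ℝ] E3 :=
  LinearIsometry.toLinearIsometryEquiv
    { toFun := rodr m t
      map_add' := fun x y => by simp only [rodr, rotF_add, smul_add]; abel
      map_smul' := fun c x => by
        simp only [rodr, rotF_smul, smul_add, RingHom.id_apply, smul_comm c]
      norm_map' := fun x => norm_rodr m t x } rfl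

theorem rotE_apply (m : Fin 3) (t : ℝ) (x : E3) : rotE m t x = rodr m t x := rfl

theorem hasDerivAt_rodr (m : Fin 3) (t : ℝ) (x : E3) :
    HasDerivAt (fun s => rodr m s x) (rotF m (rodr m t x)) t := by
  have h1 := ((Real.hasDerivAt_sin t).smul_const (rotF m x)).const_add x
  have h2 := (((Real.hasDerivAt_cos t).const_sub 1).smul_const (rotF m (rotF m x)))
  have h3 := h1.add h2
  refine h3.congr_deriv ?_
  simp only [rodr, rotF_add, rotF_smul, rotF_cube]
  module

theorem continuous_rotF (m : Fin 3) : Continuous (rotF m) := by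
  unfold rotF cross3
  apply (PiLp.continuous_toLp 2 _).comp
  refine continuous_pi fun i => ?_
  fin_cases i <;> simp <;> fun_prop

/-- The rotation on the sphere. -/
def rotS (m : Fin 3) (t : ℝ) (p : S2) : S2 :=
  ⟨rodr m t p, by
    have := p.2
    rw [mem_sphere_zero_iff_norm] at this ⊢
    rw [norm_rodr, this]⟩

theorem continuous_rotS (m : Fin 3) : Continuous (fun z : S2 × ℝ => rotS m z.2 z.1) := by
  rw [continuous_induced_rng]
  have := continuous_rotF m
  change Continuous (fun z : S2 × ℝ => rodr m z.2 z.1)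
  unfold rodr
  fun_prop

theorem S2_ne (p : S2) : (p : E3) ≠ 0 := by
  have := p.2
  rw [mem_sphere_zero_iff_norm] at this
  intro h; rw [h] at this; simp at this

theorem S2_integrable (g : S2 → ℝ) (hg : Continuous g) : Integrable g sphereMeasure :=
  hg.integrable_of_hasCompactSupport (HasCompactSupport.of_compactSpace _)

/-- integrable with vanishing integral -/
def ZI (g : S2 → ℝ) : Prop := Integrable g sphereMeasure ∧ ∫ p, g p ∂sphereMeasure = 0

theorem ZI.add {f g : S2 → ℝ} (hf : ZI f) (hg : ZI g) : ZI (fun p => f p + g p) :=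
  ⟨hf.1.add hg.1, by rw [integral_add hf.1 hg.1, hf.2, hg.2, add_zero]⟩

theorem ZI.sub {f g : S2 → ℝ} (hf : ZI f) (hg : ZI g) : ZI (fun p => f p - g p) :=
  ⟨hf.1.sub hg.1, by rw [integral_sub hf.1 hg.1, hf.2, hg.2, sub_zero]⟩

theorem ZI_rot (m : Fin 3) (f : E3 → ℝ) (hf : ContDiffOn ℝ 1 f {(0 : E3)}ᶜ) :
    ZI (fun p => fderiv ℝ f (p : E3) (rotF m p)) := by
  have hopen : IsOpen ({(0 : E3)}ᶜ : Set E3) := isOpen_compl_singleton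
  have hcd : ContinuousOn (fderiv ℝ f) {(0 : E3)}ᶜ :=
    hf.continuousOn_fderiv_of_isOpen hopen le_rfl
  set g : S2 → ℝ := fun p => fderiv ℝ f (p : E3) (rotF m p) with hgdef
  have hg : Continuous g := by
    have h1 : Continuous (fun p : S2 => fderiv ℝ f (p : E3)) :=
      hcd.comp_continuous continuous_subtype_val (fun p => S2_ne p)
    exact h1.clm_apply ((continuous_rotF m).comp continuous_subtype_val)
  have hfc : Continuous (fun p : S2 => f (p : E3)) :=
    hf.continuousOn.comp_continuous continuous_subtype_val (fun p => S2_ne p)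
  refine ⟨S2_integrable g hg, ?_⟩
  have hGc : Continuous (fun z : S2 × ℝ => g (rotS m z.2 z.1)) := hg.comp (continuous_rotS m)
  obtain ⟨C, hC⟩ : ∃ C, ∀ p, ‖g p‖ ≤ C := by
    obtain ⟨C, hC⟩ := (isCompact_univ (X := S2)).exists_bound_of_continuousOn hg.continuousOn
    exact ⟨C, fun p => hC p (Set.mem_univ _)⟩
  have hint : Integrable (Function.uncurry fun (p : S2) (t : ℝ) => g (rotS m t p))
      (sphereMeasure.prod (volume.restrict (Set.Ioc (0 : ℝ) 1))) :=
    Integrable.of_bound hGc.aestronglyMeasurable C (Filter.Eventually.of_forall fun z => hC _)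
  have hswap := integral_integral_swap hint
  have hR : ∀ t, ∫ p, g (rotS m t p) ∂sphereMeasure = ∫ p, g p ∂sphereMeasure := fun t =>
    sphere_integral_comp (rotE m t) (rotS m t) (fun p => rfl) g hg
  have hL : ∀ p : S2, ∫ t in Set.Ioc (0 : ℝ) 1, g (rotS m t p) =
      f (rotS m 1 p : E3) - f (p : E3) := by
    intro p
    rw [← intervalIntegral.integral_of_le zero_le_one]
    have h0 : f (p : E3) = f (rotS m 0 p : E3) := by simp [rotS, rodr]
    rw [h0]
    apply intervalIntegral.integral_eq_sub_of_hasDerivAt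
      (f := fun t => f (rotS m t p : E3)) (f' := fun t => g (rotS m t p))
    · intro t _
      have hd : DifferentiableAt ℝ f (rotS m t p : E3) :=
        (hf.differentiableOn one_ne_zero).differentiableAt (hopen.mem_nhds (S2_ne _))
      exact hd.hasFDerivAt.comp_hasDerivAt t (hasDerivAt_rodr m t p)
    · exact (hGc.comp (by fun_prop : Continuous fun t : ℝ => (p, t))).intervalIntegrable _ _
  simp_rw [hL, hR] at hswap
  have hfc1 : Continuous (fun p : S2 => f (rotS m 1 p : E3)) :=
    hfc.comp ((continuous_rotS m).comp (by fun_prop : Continuous fun p : S2 => (p, (1 : ℝ))))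
  rw [integral_sub (S2_integrable _ hfc1) (S2_integrable _ hfc),
    sphere_integral_comp (rotE m 1) (rotS m 1) (fun p => rfl) (fun p => f (p : E3)) hfc] at hswap
  simpa using hswap.symm

theorem fderiv_expand (f : E3 → ℝ) (x v : E3) :
    fderiv ℝ f x v = v 0 * fderiv ℝ f x (e3 0) + v 1 * fderiv ℝ f x (e3 1)
      + v 2 * fderiv ℝ f x (e3 2) := by
  have hv : v = v 0 • e3 0 + v 1 • e3 1 + v 2 • e3 2 := by
    ext i; fin_cases i <;> simp [e3]
  conv_lhs => rw [hv]
  simp only [map_add, map_smul, smul_eq_mul]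

theorem hasFDerivAt_coord (a : Fin 3) (x : E3) :
    HasFDerivAt (fun y : E3 => y a) (EuclideanSpace.proj a : E3 →L[ℝ] ℝ) x :=
  (EuclideanSpace.proj a : E3 →L[ℝ] ℝ).hasFDerivAt

theorem fderiv_mul1 (a : Fin 3) (f : E3 → ℝ) (x v : E3) (hf : DifferentiableAt ℝ f x) :
    fderiv ℝ (fun y : E3 => y a * f y) x v = v a * f x + x a * fderiv ℝ f x v := by
  rw [((hasFDerivAt_coord a x).fun_mul hf.hasFDerivAt).fderiv]
  simp; ring

theorem fderiv_mul2 (a k : Fin 3) (f : E3 → ℝ) (x v : E3) (hf : DifferentiableAt ℝ f x) :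
    fderiv ℝ (fun y : E3 => y a * (y k * f y)) x v
      = v a * (x k * f x) + x a * (v k * f x + x k * fderiv ℝ f x v) := by
  have h2 : DifferentiableAt ℝ (fun y : E3 => y k * f y) x :=
    (hasFDerivAt_coord k x).differentiableAt.mul hf
  rw [fderiv_mul1 a _ x v h2, fderiv_mul1 k f x v hf]

theorem contDiff_coord (a : Fin 3) (s : Set E3) : ContDiffOn ℝ 1 (fun y : E3 => y a) s :=
  (EuclideanSpace.proj a : E3 →L[ℝ] ℝ).contDiff.contDiffOn

theorem rotF_0 (x : E3) : rotF 0 x 0 = 0 ∧ rotF 0 x 1 = - x 2 ∧ rotF 0 x 2 = x 1 := by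
  simp [rotF, cross3, e3]
theorem rotF_1 (x : E3) : rotF 1 x 0 = x 2 ∧ rotF 1 x 1 = 0 ∧ rotF 1 x 2 = - x 0 := by
  simp [rotF, cross3, e3]
theorem rotF_2 (x : E3) : rotF 2 x 0 = - x 1 ∧ rotF 2 x 1 = x 0 ∧ rotF 2 x 2 = 0 := by
  simp [rotF, cross3, e3]

theorem S2_sq (p : S2) : (p : E3) 0 ^ 2 + (p : E3) 1 ^ 2 + (p : E3) 2 ^ 2 = 1 := by
  have := p.2
  rw [mem_sphere_zero_iff_norm, EuclideanSpace.norm_eq] at this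
  have h2 := Real.sqrt_eq_one.mp this
  simpa [Fin.sum_univ_three] using h2

/-- Tangential divergence theorem for `x_a u_j`, with `u` tangential of degree zero. -/
theorem ZI_div (a : Fin 3) (u : Fin 3 → E3 → ℝ)
    (hu : ∀ j, ContDiffOn ℝ 1 (u j) {(0 : E3)}ᶜ)
    (ht : ∀ x : E3, x 0 * u 0 x + x 1 * u 1 x + x 2 * u 2 x = 0)
    (hr : ∀ j (x : E3), x ≠ 0 → fderiv ℝ (u j) x x = 0) :
    ZI (fun p => (p : E3) a * (fderiv ℝ (u 0) p (e3 0) + fderiv ℝ (u 1) p (e3 1)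
      + fderiv ℝ (u 2) p (e3 2)) + u a p) := by
  have hc : ∀ k j, ContDiffOn ℝ 1 (fun y : E3 => y a * (y k * u j y)) {(0 : E3)}ᶜ := fun k j =>
    (contDiff_coord a _).mul ((contDiff_coord k _).mul (hu j))
  have key := ((((((ZI_rot 2 _ (hc 0 1)).sub (ZI_rot 2 _ (hc 1 0))).add
    (ZI_rot 0 _ (hc 1 2))).sub (ZI_rot 0 _ (hc 2 1))).add
    (ZI_rot 1 _ (hc 2 0))).sub (ZI_rot 1 _ (hc 0 2)))
  convert key using 2 with p
  have hd : ∀ j, DifferentiableAt ℝ (u j) (p : E3) := fun j =>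
    ((hu j).differentiableOn one_ne_zero).differentiableAt
      (isOpen_compl_singleton.mem_nhds (S2_ne p))
  have h0 := hr 0 p (S2_ne p)
  have h1 := hr 1 p (S2_ne p)
  have h2 := hr 2 p (S2_ne p)
  have hs := S2_sq p
  have ht := ht p
  obtain ⟨r00, r01, r02⟩ := rotF_0 p
  obtain ⟨r10, r11, r12⟩ := rotF_1 p
  obtain ⟨r20, r21, r22⟩ := rotF_2 p
  rw [fderiv_expand] at h0 h1 h2
  simp only [fderiv_mul2 _ _ _ _ _ (hd _)]
  simp only [fderiv_expand _ _ (rotF _ _), r00, r01, r02, r10, r11, r12, r20, r21, r22]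
  generalize (p : E3) = x at *
  generalize fderiv ℝ (u 0) x (e3 0) = d00 at *
  generalize fderiv ℝ (u 0) x (e3 1) = d01 at *
  generalize fderiv ℝ (u 0) x (e3 2) = d02 at *
  generalize fderiv ℝ (u 1) x (e3 0) = d10 at *
  generalize fderiv ℝ (u 1) x (e3 1) = d11 at *
  generalize fderiv ℝ (u 1) x (e3 2) = d12 at *
  generalize fderiv ℝ (u 2) x (e3 0) = d20 at *
  generalize fderiv ℝ (u 2) x (e3 1) = d21 at *
  generalize fderiv ℝ (u 2) x (e3 2) = d22 at *
  fin_cases a <;> simp [r00, r01, r02, r10, r11, r12, r20, r21, r22]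
  · linear_combination (-x 0 * (d00 + d11 + d22) - u 0 x) * hs + x 0 * (x 0 * h0 + x 1 * h1 + x 2 * h2) + 3 * x 0 * ht
  · linear_combination (-x 1 * (d00 + d11 + d22) - u 1 x) * hs + x 1 * (x 0 * h0 + x 1 * h1 + x 2 * h2) + 3 * x 1 * ht
  · linear_combination (-x 2 * (d00 + d11 + d22) - u 2 x) * hs + x 2 * (x 0 * h0 + x 1 * h1 + x 2 * h2) + 3 * x 2 * ht

theorem gen_apply2 {E : Type*} [NormedAddCommGroup E] [NormedSpace ℝ E]
    (H : E → E →L[ℝ] E →L[ℝ] ℝ) (x : E) (hd : DifferentiableAt ℝ H x) (v w z : E) :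
    fderiv ℝ (fun y => H y v w) x z = fderiv ℝ H x z v w := by
  have h0 : HasFDerivAt (fun y => H y v) ((fderiv ℝ H x).flip v) x := by
    have := hd.hasFDerivAt.clm_apply (hasFDerivAt_const v x)
    refine this.congr_fderiv ?_
    ext; simp
  have h1 : HasFDerivAt (fun y => H y v w) (((fderiv ℝ H x).flip v).flip w) x := by
    have := h0.clm_apply (hasFDerivAt_const w x)
    refine this.congr_fderiv ?_
    ext; simp
  rw [h1.fderiv]; rfl

theorem gen_tang {E : Type*} [NormedAddCommGroup E] [NormedSpace ℝ E]
    (H : E → E →L[ℝ] E →L[ℝ] ℝ) (x : E) (hd : DifferentiableAt ℝ H x)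
    (htang : ∀ x v, H x x v = 0) (w z : E) :
    fderiv ℝ H x z x w = - H x z w := by
  have h0 : HasFDerivAt (fun y => H y y) (H x + (fderiv ℝ H x).flip x) x := by
    have := hd.hasFDerivAt.clm_apply (hasFDerivAt_id x)
    refine this.congr_fderiv ?_
    ext; simp
  have h1 : HasFDerivAt (fun y => H y y w) ((H x + (fderiv ℝ H x).flip x).flip w) x := by
    have := h0.clm_apply (hasFDerivAt_const w x)
    refine this.congr_fderiv ?_
    ext; simp
  have h2 : HasFDerivAt (fun y => H y y w) (0 : E →L[ℝ] ℝ) x := by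
    simp only [htang]; exact hasFDerivAt_const 0 x
  have h3 := congrArg (fun L : E →L[ℝ] ℝ => L z) (h1.unique h2)
  simp at h3
  linarith

theorem gen_rad {E : Type*} [NormedAddCommGroup E] [NormedSpace ℝ E]
    (H : E → E →L[ℝ] E →L[ℝ] ℝ) (x : E) (hd : DifferentiableAt ℝ H x)
    (hhom : ∀ c : ℝ, 0 < c → ∀ x, H (c • x) = H x) :
    fderiv ℝ H x x = 0 := by
  ext v w
  rw [← gen_apply2 H x hd]
  have hd' : DifferentiableAt ℝ (fun y => H y v w) x :=
    (hd.clm_apply (differentiableAt_const v)).clm_apply (differentiableAt_const w)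
  have hl : HasDerivAt (fun t : ℝ => t • x) x 1 := by
    simpa using (hasDerivAt_id (1 : ℝ)).smul_const x
  have hc : HasDerivAt (fun t : ℝ => H (t • x) v w) (fderiv ℝ (fun y => H y v w) x x) 1 := by
    have h1 : HasFDerivAt (fun y => H y v w) (fderiv ℝ (fun y => H y v w) x) ((1 : ℝ) • x) := by
      rw [one_smul]; exact hd'.hasFDerivAt
    exact h1.comp_hasDerivAt 1 hl
  have hk : HasDerivAt (fun t : ℝ => H (t • x) v w) 0 1 := by
    refine (hasDerivAt_const (1 : ℝ) (H x v w)).congr_of_eventuallyEq ?_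
    filter_upwards [lt_mem_nhds (zero_lt_one : (0 : ℝ) < 1)] with t ht
    rw [hhom t ht x]
  exact hc.unique hk

/-- For each `l` and any smooth tangential symmetric `(0,2)`-tensor field `ĥ` on `S²`
(presented as a degree-zero homogeneous ambient field `H`),
`∫_{S²} x^l ε^{ac} ∇_c ∇_b ĥ^b_a dμ = 0`; here `ε^{ac} ∇_c α_a` of the one-form
`α = ∇_b ĥ^b_a` is the normal component `⟪ν, curl α♯⟫` of the ambient curl. -/
theorem integral_curl_div_symm_tensor (l : Fin 3)
    (H : E3 → E3 →L[ℝ] E3 →L[ℝ] ℝ)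
    (hsmooth : ContDiffOn ℝ (⊤ : ℕ∞) H {(0 : E3)}ᶜ)
    (hsymm : ∀ x v w, H x v w = H x w v)
    (htang : ∀ x v, H x x v = 0)
    (hhom : ∀ c : ℝ, 0 < c → ∀ x, H (c • x) = H x) :
    ∫ p : S2, coordFn l p * ⟪(p : E3), curl3 (tensorDivVec H) (p : E3)⟫ ∂sphereMeasure
      = 0 := by
  have hopen : IsOpen ({(0 : E3)}ᶜ : Set E3) := isOpen_compl_singleton
  have hHd : ∀ x : E3, x ≠ 0 → DifferentiableAt ℝ H x := fun x hx =>
    (hsmooth.differentiableOn (by simp)).differentiableAt (hopen.mem_nhds hx)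
  have hrad : ∀ x : E3, x ≠ 0 → ∀ v w, fderiv ℝ H x x v w = 0 := fun x hx v w => by
    rw [gen_rad H x (hHd x hx) hhom]; rfl
  have hu : ∀ x : E3, x ≠ 0 → ∀ v w z, fderiv ℝ (fun y => H y v w) x z = fderiv ℝ H x z v w :=
    fun x hx v w z => gen_apply2 H x (hHd x hx) v w z
  have htd : ∀ x : E3, x ≠ 0 → ∀ w z, fderiv ℝ H x z x w = - H x z w :=
    fun x hx w z => gen_tang H x (hHd x hx) htang w z
  have hexp : ∀ x : E3, x = x 0 • e3 0 + x 1 • e3 1 + x 2 • e3 2 := by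
    intro x; ext i; fin_cases i <;> simp [e3]
  have htan : ∀ (c : Fin 3) (x : E3), x 0 * H x (e3 0) (e3 c) + x 1 * H x (e3 1) (e3 c)
      + x 2 * H x (e3 2) (e3 c) = 0 := by
    intro c x
    have h := htang x (e3 c)
    have h' : H x (x 0 • e3 0 + x 1 • e3 1 + x 2 • e3 2) (e3 c) = 0 := by rw [← hexp x]; exact h
    simpa using h'
  have hW : ∀ x : E3, x ≠ 0 → ∀ c, tensorDivVec H x c =
      ∑ j : Fin 3, fderiv ℝ H x (e3 j) (e3 j) (e3 c) := by
    intro x hx c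
    have hin : ∀ j, ⟪x, e3 j⟫ = x j := by
      intro j; simp [e3, EuclideanSpace.inner_single_right]
    have h1 : tensorDivVec H x c =
        ∑ j : Fin 3, fderiv ℝ H x (tangProj x (e3 j)) (tangProj x (e3 j)) (e3 c) := by
      unfold tensorDivVec
      generalize (fun i => ∑ j : Fin 3,
        fderiv ℝ H x (tangProj x (e3 j)) (tangProj x (e3 j)) (e3 i)) = F
      fin_cases c <;> simp [Fin.sum_univ_three, e3]
    rw [h1]
    simp only [tangProj, map_sub, map_smul, hrad x hx, hin,
      sub_apply, smul_apply, htd x hx,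
      Fin.sum_univ_three, smul_eq_mul]
    have := htan c x
    linear_combination (⟪x, x⟫)⁻¹ * this
  have hucd : ∀ j c, ContDiffOn ℝ 1 (fun y => H y (e3 j) (e3 c)) {(0 : E3)}ᶜ := by
    intro j c
    exact ((hsmooth.of_le (by exact_mod_cast le_top)).clm_apply contDiffOn_const).clm_apply
      contDiffOn_const
  have hucd2 : ∀ j c, ContDiffOn ℝ 2 (fun y => H y (e3 j) (e3 c)) {(0 : E3)}ᶜ := by
    intro j c
    exact ((hsmooth.of_le (WithTop.coe_le_coe.2 (le_top : (2 : ℕ∞) ≤ ⊤))).clm_apply contDiffOn_const).clm_apply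
      contDiffOn_const
  have hWcd : ∀ c, ContDiffOn ℝ 1 (fun y => tensorDivVec H y c) {(0 : E3)}ᶜ := by
    intro c
    have h : ContDiffOn ℝ 1 (fun x => ∑ j : Fin 3,
        fderiv ℝ (fun y => H y (e3 j) (e3 c)) x (e3 j)) {(0 : E3)}ᶜ :=
      ContDiffOn.sum fun j _ => ((hucd2 j c).fderiv_of_isOpen hopen
        (by norm_num)).clm_apply contDiffOn_const
    refine h.congr fun x hx => ?_
    rw [hW x hx c]
    exact Finset.sum_congr rfl fun j _ => (hu x hx _ _ _).symm
  have hB : ∀ a c, ZI (fun p => (p : E3) a * tensorDivVec H p c + H p (e3 a) (e3 c)) := by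
    intro a c
    have h := ZI_div a (fun j y => H y (e3 j) (e3 c)) (fun j => hucd j c) (htan c)
      (fun j x hx => by rw [hu x hx, hrad x hx])
    convert h using 4 with p
    rw [hW p (S2_ne p), Fin.sum_univ_three, hu p (S2_ne p), hu p (S2_ne p), hu p (S2_ne p)]
  have hA : ∀ m, ZI (fun p => fderiv ℝ (fun y : E3 => y l * tensorDivVec H y m) (p : E3)
      (rotF m p)) := fun m => ZI_rot m _ ((contDiff_coord l _).mul (hWcd m))
  have key := (((hA 0).add (hA 1)).add (hA 2)).sub ((hB (l + 2) (l + 1)).sub (hB (l + 1) (l + 2)))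
  refine Eq.trans ?_ key.2
  congr 1
  funext p
  have hd : ∀ j, DifferentiableAt ℝ (fun y => tensorDivVec H y j) (p : E3) := fun j =>
    ((hWcd j).differentiableOn one_ne_zero).differentiableAt (hopen.mem_nhds (S2_ne p))
  obtain ⟨r00, r01, r02⟩ := rotF_0 p
  obtain ⟨r10, r11, r12⟩ := rotF_1 p
  obtain ⟨r20, r21, r22⟩ := rotF_2 p
  have hs := hsymm p (e3 (l + 2)) (e3 (l + 1))
  simp only [fderiv_mul1 _ _ _ _ (hd _)]
  simp only [fderiv_expand _ _ (rotF _ _), r00, r01, r02, r10, r11, r12, r20, r21, r22]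
  simp only [coordFn, curl3, PiLp.inner_apply, Fin.sum_univ_three]
  fin_cases l <;> simp [r00, r01, r02, r10, r11, r12, r20, r21, r22] at hs ⊢ <;>
    linear_combination hs
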